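/- Assume ◊. Then there exists a Hausdorff, hereditarily Lindelöf topological space X of size ω₁ that is not a D-space and such that the finite power X^n is Lindelöf for every natural number n ≥ 1. -/

import Mathlib

open Ordinal Set

/-- `ω₁` viewed as the set (type) of all countable ordinals. -/
abbrev Omega1 : Type 1 := {o : Ordinal // o < ω₁}

/-- `C ⊆ ω₁` is club: unbounded, and closed under limits of its elements. -/
def IsClubIn (C : Set Omega1) : Prop :=
  (∀ a : Omega1, ∃ c ∈ C, a < c) ∧
  ∀ a : Omega1, (∃ b, b < a) → (∀ b < a, ∃ c ∈ C, b < c ∧ c < a) → a ∈ C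

/-- `S ⊆ ω₁` is stationary: it meets every closed unbounded subset of `ω₁`. -/
def IsStationaryIn (S : Set Omega1) : Prop :=
  ∀ C : Set Omega1, IsClubIn C → (S ∩ C).Nonempty

/-- The diamond principle `◊`: there is a sequence `⟨A α : α < ω₁⟩` with `A α ⊆ α`
such that for every `B ⊆ ω₁` the set `{α | B ∩ α = A α}` is stationary in `ω₁`. -/
def DiamondPrinciple : Prop :=
  ∃ A : Omega1 → Set Omega1,
    (∀ α : Omega1, A α ⊆ {β | β < α}) ∧
    ∀ B : Set Omega1, IsStationaryIn {α | B ∩ {β | β < α} = A α}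

/-- A `T₁` space `X` is a `D`-space if for every open neighbourhood assignment
`x ↦ U x` there is a closed discrete `D ⊆ X` with `⋃ x ∈ D, U x = X`. -/
def IsDSpace (X : Type*) [TopologicalSpace X] : Prop :=
  ∀ U : X → Set X, (∀ x, IsOpen (U x) ∧ x ∈ U x) →
    ∃ D : Set X, IsClosed D ∧ DiscreteTopology D ∧ (⋃ x ∈ D, U x) = Set.univ

namespace Omega1

theorem countable_Iio (a : Omega1) : (Iio a).Countable := by
  have h : (Iio (a : Ordinal)).Countable := by
    rw [← Cardinal.le_aleph0_iff_set_countable, Cardinal.mk_Iio_ordinal, ← Cardinal.lift_aleph0.{1, 0},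
      Cardinal.lift_le]
    have h1 : (a : Ordinal).card < Cardinal.aleph 1 :=
      Cardinal.lt_ord.1 (by rw [Cardinal.ord_aleph]; exact a.2)
    rw [← Cardinal.succ_aleph0] at h1
    exact Order.lt_succ_iff.1 h1
  exact (h.preimage Subtype.val_injective).mono fun b hb => hb

theorem mk_eq : Cardinal.mk Omega1 = Cardinal.aleph 1 := by
  have h : Cardinal.mk (Iio (ω₁ : Ordinal.{0})) = Cardinal.lift.{1} (ω₁ : Ordinal.{0}).card :=
    Cardinal.mk_Iio_ordinal _
  rw [Ordinal.card_omega, Cardinal.lift_aleph, Ordinal.lift_one] at h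
  exact h

instance : Uncountable Omega1 := by
  rw [← Cardinal.aleph0_lt_mk_iff, mk_eq]
  exact Cardinal.aleph0_lt_aleph_one

theorem countable_Iic (a : Omega1) : (Iic a).Countable := by
  rw [← Iio_insert]
  exact (countable_Iio a).insert a

theorem exists_gt_of_countable {s : Set Omega1} (hs : s.Countable) : ∃ a, ∀ b ∈ s, b < a := by
  by_contra! h
  refine not_countable_univ (α := Omega1) ?_
  have : (univ : Set Omega1) = ⋃ b ∈ s, Iic b := by
    ext a
    simpa using h a
  rw [this]
  exact hs.biUnion fun b _ => countable_Iic b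

theorem exists_gt_range {ι : Sort*} [Countable ι] (f : ι → Omega1) : ∃ a, ∀ i, f i < a := by
  obtain ⟨a, ha⟩ := exists_gt_of_countable (countable_range f)
  exact ⟨a, fun i => ha _ (mem_range_self i)⟩

theorem isClubIn_closed_under (h : Omega1 → Omega1) :
    IsClubIn {δ | (∃ b, b < δ) ∧ ∀ β < δ, h β < δ} := by
  constructor
  · intro a
    have step : ∀ b : Omega1, ∃ c, b < c ∧ ∀ β ≤ b, h β < c := fun b => by
      obtain ⟨c, hc⟩ := exists_gt_of_countable (((countable_Iic b).image h).insert b)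
      exact ⟨c, hc b (mem_insert _ _),
        fun β hβ => hc _ (mem_insert_of_mem _ (mem_image_of_mem h hβ))⟩
    choose g hg₁ hg₂ using step
    let u : ℕ → Omega1 := fun n => g^[n] a
    have hu : ∀ n, u (n + 1) = g (u n) := fun n => Function.iterate_succ_apply' g n a
    obtain ⟨c, hc, hmin⟩ := WellFounded.has_min (wellFounded_lt (α := Omega1))
      {c | ∀ n, u n < c} (exists_gt_range u)
    have key : ∀ β < c, ∃ n, β ≤ u n := fun β hβ => by
      by_contra! h'
      exact hmin β h' hβ
    refine ⟨c, ⟨⟨a, hc 0⟩, fun β hβ => ?_⟩, hc 0⟩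
    obtain ⟨n, hn⟩ := key β hβ
    exact ((hg₂ (u n) β hn).trans_eq (hu n).symm).trans (hc (n + 1))
  · rintro a ha hlim
    refine ⟨ha, fun β hβ => ?_⟩
    obtain ⟨c, hc, hβc, hca⟩ := hlim β hβ
    exact (hc.2 β hβc).trans hca

theorem exists_of_recursion {V : Type*} [Inhabited V] (P : Omega1 → (Omega1 → V) → V → Prop)
    (hlocal : ∀ δ g g' v, (∀ β < δ, g β = g' β) → P δ g v → P δ g' v)
    (hstep : ∀ δ g, (∀ β < δ, P β g (g β)) → ∃ v, P δ g v) :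
    ∃ f : Omega1 → V, ∀ δ, P δ f (f δ) := by
  classical
  let ext : ∀ δ : Omega1, (∀ β, β < δ → V) → Omega1 → V :=
    fun δ g β => if h : β < δ then g β h else default
  let f : Omega1 → V := (wellFounded_lt (α := Omega1)).fix
    fun δ g => Classical.epsilon fun v => P δ (ext δ g) v
  have hf : ∀ δ, f δ = Classical.epsilon fun v => P δ (ext δ fun β _ => f β) v :=
    fun δ => WellFounded.fix_eq _ _ _
  refine ⟨f, fun δ => ?_⟩
  induction δ using WellFoundedLT.induction with
  | ind δ ih =>
    obtain ⟨v, hv⟩ := hstep δ f ih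
    have heq : ∀ β < δ, f β = ext δ (fun β _ => f β) β := fun β hβ => by simp [ext, hβ]
    have := Classical.epsilon_spec (p := fun v => P δ (ext δ fun β _ => f β) v)
      ⟨v, hlocal _ _ _ _ heq hv⟩
    rw [← hf] at this
    exact hlocal _ _ _ _ (fun β hβ => (heq β hβ).symm) this

end Omega1

/-- The underlying set of the space. -/
abbrev Pt : Type 1 := Omega1 × ℕ

namespace Pt

theorem mk_eq : Cardinal.mk Pt = Cardinal.aleph 1 := by
  rw [Cardinal.mk_prod, Omega1.mk_eq]
  simp

theorem countable_fst_lt (a : Omega1) : {p : Pt | p.1 < a}.Countable := by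
  have := (Omega1.countable_Iio a).prod (countable_univ (α := ℕ))
  exact this.mono fun p hp => mk_mem_prod hp (mem_univ _)

theorem countable_finset_le (a : Omega1) : {F : Finset Pt | ∀ x ∈ F, x.1 ≤ a}.Countable := by
  have h : {p : Pt | p.1 ≤ a}.Countable :=
    ((Omega1.countable_Iic a).prod (countable_univ (α := ℕ))).mono
      fun p hp => mk_mem_prod hp (mem_univ _)
  have := h.to_subtype
  refine (countable_range fun G : Finset {p : Pt | p.1 ≤ a} =>
    G.map (Function.Embedding.subtype _)).mono fun F hF => ?_
  exact ⟨F.subtype _, Finset.subtype_map_of_mem hF⟩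

end Pt

/-- Diamond for families of finite sets of points. -/
theorem DiamondPrinciple.exists_finset_guess (hd : DiamondPrinciple) :
    ∃ A : Omega1 → Set (Finset Pt), ∀ (B : Set (Finset Pt)) (h : Omega1 → Omega1),
      ∃ δ, (∃ b, b < δ) ∧ (∀ β < δ, h β < δ) ∧
        ∀ F, F ∈ A δ ↔ F ∈ B ∧ ∀ x ∈ F, x.1 < δ := by
  obtain ⟨A, -, hA⟩ := hd
  have hc : Cardinal.mk (Finset Pt) = Cardinal.mk Omega1 := by
    have : Infinite Pt := Cardinal.infinite_iff.2 (by
      rw [Pt.mk_eq]; exact Cardinal.aleph0_lt_aleph_one.le)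
    rw [Cardinal.mk_finset_of_infinite, Pt.mk_eq, Omega1.mk_eq]
  obtain ⟨e⟩ := Cardinal.eq.1 hc
  refine ⟨fun δ => {F | e F ∈ A δ ∧ ∀ x ∈ F, x.1 < δ}, fun B h => ?_⟩
  have hk : ∀ β : Omega1, ∃ c, h β < c ∧ (∀ x ∈ e.symm β, x.1 < c) ∧
      ∀ F : Finset Pt, (∀ x ∈ F, x.1 ≤ β) → e F < c := by
    intro β
    obtain ⟨c, hc⟩ := Omega1.exists_gt_of_countable
      ((((Pt.countable_finset_le β).image e).union ((e.symm β).finite_toSet.countable.image Prod.fst)).insert (h β))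
    refine ⟨c, hc _ (mem_insert _ _), fun x hx => hc _ ?_, fun F hF => hc _ ?_⟩
    · exact mem_insert_of_mem _ (Or.inr ⟨x, hx, rfl⟩)
    · exact mem_insert_of_mem _ (Or.inl ⟨F, hF, rfl⟩)
  choose k hk₁ hk₂ hk₃ using hk
  obtain ⟨δ, hδ, hb, hkδ⟩ := hA (e '' B) _ (Omega1.isClubIn_closed_under k)
  refine ⟨δ, hb, fun β hβ => (hk₁ β).trans (hkδ β hβ), fun F => ?_⟩
  have hδ' : ∀ a, a ∈ A δ ↔ a ∈ e '' B ∧ a < δ := fun a => by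
    rw [← show e '' B ∩ {β | β < δ} = A δ from hδ]; rfl
  have hlt : (∀ x ∈ F, x.1 < δ) → e F < δ := by
    intro hF
    obtain ⟨b, hb⟩ := hb
    rcases F.eq_empty_or_nonempty with rfl | hne
    · exact (hk₃ b _ (by simp)).trans (hkδ b hb)
    · obtain ⟨x, hx, hmax⟩ := F.exists_max_image Prod.fst hne
      exact (hk₃ x.1 F hmax).trans (hkδ _ (hF x hx))
  simp only [mem_ofPred_eq, hδ', e.injective.mem_set_image]
  tauto

/-- What is chosen at a level `δ < ω₁`: the set `nbr` of those `p` below level `δ` whose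
neighbourhood contains the points of level `δ`, the positions `pos` of these points in the Cantor
set, and a sequence `seq` of finite sets of points below level `δ`. -/
structure Level where
  nbr : Set Pt
  pos : ℕ → ℕ → Bool
  seq : ℕ → Finset Pt

instance : Inhabited Level := ⟨⟨univ, fun _ _ => false, fun _ => ∅⟩⟩

namespace Level

open Filter

/-- The points of level `y` belong to the neighbourhood attached to `p`. -/
def Covers (g : Omega1 → Level) (p : Pt) (y : Omega1) : Prop :=
  y ≤ p.1 ∨ p ∈ (g y).nbr

/-- The level `v` is an admissible choice at `δ` after the choices `g β`, `β < δ`. -/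
structure Admissible (δ : Omega1) (g : Omega1 → Level) (v : Level) : Prop where
  pos_injective : Function.Injective v.pos
  pos_ne : ∀ β < δ, ∀ i j, v.pos j ≠ (g β).pos i
  frequently_nbr : ∀ β < δ, ∀ H : Finset Omega1, (∀ y ∈ H, β < y ∧ y < δ) →
    ∃ᶠ i in atTop, ∀ p ∈ (g β).seq i, p ∈ v.nbr ∧ ∀ y ∈ H, Covers g p y
  seq_lt : ∀ i, ∀ x ∈ v.seq i, x.1 < δ
  seq_pos : ∃ n, ∀ i, ∀ x ∈ v.seq i, ∃ j < n, ∀ k < i, (g x.1).pos x.2 k = v.pos j k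
  seq_nbr : ∀ p ∈ v.nbr, p.1 < δ → ∀ᶠ i in atTop, ∀ x ∈ v.seq i, Covers g p x.1

/-- Some admissible choice at `δ` has a sequence taken from the guessed family `A`. -/
def Catches (A : Set (Finset Pt)) (δ : Omega1) (g : Omega1 → Level) : Prop :=
  ∃ v, Admissible δ g v ∧ ∀ i, v.seq i ∈ A

/-- The sequences of the earlier levels allow level `δ` to avoid `⋃ A`. -/
def Avoids (A : Set (Finset Pt)) (δ : Omega1) (g : Omega1 → Level) : Prop :=
  ∀ β < δ, ∀ H : Finset Omega1, (∀ y ∈ H, β < y ∧ y < δ) →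
    ∃ᶠ i in atTop, ∀ p ∈ (g β).seq i, (∀ F ∈ A, p ∉ F) ∧ ∀ y ∈ H, Covers g p y

/-- The requirement on the choice `v` at `δ`, where `A` is the guessed family. -/
structure Correct (A : Set (Finset Pt)) (δ : Omega1) (g : Omega1 → Level) (v : Level) : Prop where
  admissible : Admissible δ g v
  seq_mem : Catches A δ g → ∀ i, v.seq i ∈ A
  nbr_disjoint : ¬ Catches A δ g → Avoids A δ g → ∀ p ∈ v.nbr, ∀ F ∈ A, p ∉ F

theorem covers_congr {δ : Omega1} {g g' : Omega1 → Level}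
    (h : ∀ β < δ, g β = g' β) {p : Pt} {y : Omega1} (hy : y < δ) : Covers g p y ↔ Covers g' p y := by
  rw [Covers, Covers, h y hy]

theorem Admissible.congr {δ : Omega1} {g g' : Omega1 → Level}
    (h : ∀ β < δ, g β = g' β) {v : Level} (hv : Admissible δ g v) : Admissible δ g' v where
  pos_injective := hv.pos_injective
  pos_ne β hβ := h β hβ ▸ hv.pos_ne β hβ
  frequently_nbr β hβ H hH := by
    rw [← h β hβ]
    refine (hv.frequently_nbr β hβ H hH).mono fun i hi p hp => ⟨(hi p hp).1, fun y hy => ?_⟩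
    exact (covers_congr h (hH y hy).2).1 ((hi p hp).2 y hy)
  seq_lt := hv.seq_lt
  seq_pos := by
    obtain ⟨n, hn⟩ := hv.seq_pos
    refine ⟨n, fun i x hx => ?_⟩
    rw [← h _ (hv.seq_lt i x hx)]
    exact hn i x hx
  seq_nbr p hp hpδ := by
    refine (hv.seq_nbr p hp hpδ).mono fun i hi x hx => ?_
    exact (covers_congr h (hv.seq_lt i x hx)).1 (hi x hx)

theorem Catches.congr {δ : Omega1} {g g' : Omega1 → Level}
    (h : ∀ β < δ, g β = g' β) {A : Set (Finset Pt)} (hc : Catches A δ g) : Catches A δ g' :=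
  let ⟨v, hv, hA⟩ := hc
  ⟨v, hv.congr h, hA⟩

theorem Avoids.congr {δ : Omega1} {g g' : Omega1 → Level}
    (h : ∀ β < δ, g β = g' β) {A : Set (Finset Pt)} (ha : Avoids A δ g) : Avoids A δ g' := by
  intro β hβ H hH
  rw [← h β hβ]
  refine (ha β hβ H hH).mono fun i hi p hp => ⟨(hi p hp).1, fun y hy => ?_⟩
  exact (covers_congr h (hH y hy).2).1 ((hi p hp).2 y hy)

theorem Correct.congr {δ : Omega1} {g g' : Omega1 → Level}
    (h : ∀ β < δ, g β = g' β) {A : Set (Finset Pt)} {v : Level} (hv : Correct A δ g v) :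
    Correct A δ g' v where
  admissible := hv.admissible.congr h
  seq_mem hc := hv.seq_mem (hc.congr fun β hβ => (h β hβ).symm)
  nbr_disjoint hc ha :=
    hv.nbr_disjoint (fun hc' => hc (hc'.congr h)) (ha.congr fun β hβ => (h β hβ).symm)

/-- The sequence chosen at `β` frequently lies in the neighbourhood trace of any finitely many
later levels. -/
theorem frequently_covers {g : Omega1 → Level} {β : Omega1} (H : Finset Omega1)
    (hg : ∀ y ∈ H, Admissible y g (g y)) (hH : ∀ y ∈ H, β < y) :
    ∃ᶠ i in atTop, ∀ p ∈ (g β).seq i, ∀ y ∈ H, Covers g p y := by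
  classical
  rcases H.eq_empty_or_nonempty with rfl | hne
  · exact (Eventually.of_forall fun i p _ y hy => absurd hy (Finset.notMem_empty y)).frequently
  have hmem := H.max'_mem hne
  refine ((hg _ hmem).frequently_nbr β (hH _ hmem) (H.erase (H.max' hne)) fun y hy => ?_).mono
    fun i hi p hp y hy => ?_
  · exact ⟨hH y (Finset.mem_of_mem_erase hy), H.lt_max'_of_mem_erase_max' hne hy⟩
  · by_cases hy' : y = H.max' hne
    · rw [hy']
      exact Or.inr (hi p hp).1
    · exact (hi p hp).2 y (Finset.mem_erase.2 ⟨hy', hy⟩)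

theorem exists_new_pos (δ : Omega1) (g : Omega1 → Level) :
    ∃ r : ℕ → ℕ → Bool, Function.Injective r ∧ ∀ β < δ, ∀ i j, r j ≠ (g β).pos i := by
  let s : Set (ℕ → Bool) := (fun p : Pt => (g p.1).pos p.2) '' {p | p.1 < δ}
  have hs : s.Countable := (Pt.countable_fst_lt δ).image _
  have hinf : sᶜ.Infinite := by
    intro hfin
    have : Uncountable (ℕ → Bool) := by
      rw [← Cardinal.aleph0_lt_mk_iff]
      simp [Cardinal.aleph0_lt_continuum]
    refine not_countable_univ (α := ℕ → Bool) ?_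
    rw [← union_compl_self s]
    exact hs.union hfin.countable
  refine ⟨fun n => hinf.natEmbedding _ n, fun a b hab => ?_, fun β hβ i j heq => ?_⟩
  · exact (hinf.natEmbedding _).injective (Subtype.ext hab)
  · exact (hinf.natEmbedding _ j).2 ⟨(β, i), hβ, heq.symm⟩

theorem exists_correct (A : Set (Finset Pt)) (δ : Omega1) (g : Omega1 → Level)
    (hg : ∀ β < δ, Admissible β g (g β)) : ∃ v, Correct A δ g v := by
  by_cases hc : Catches A δ g
  · obtain ⟨v, hv, hA⟩ := hc
    exact ⟨v, hv, fun _ => hA, fun h => (h ⟨v, hv, hA⟩).elim⟩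
  obtain ⟨r, hr, hr'⟩ := exists_new_pos δ g
  refine ⟨⟨{p | Avoids A δ g → ∀ F ∈ A, p ∉ F}, r, fun _ => ∅⟩,
    ⟨hr, hr', fun β hβ H hH => ?_, by simp, ⟨0, by simp⟩, by simp⟩, fun h => (hc h).elim,
    fun _ ha p hp => hp ha⟩
  by_cases ha : Avoids A δ g
  · exact (ha β hβ H hH).mono fun i hi p hp => ⟨fun _ => (hi p hp).1, (hi p hp).2⟩
  · exact (frequently_covers H (fun y hy => hg y (hH y hy).2) fun y hy => (hH y hy).1).mono
      fun i hi p hp => ⟨fun h => (ha h).elim, hi p hp⟩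

theorem exists_correct_levels (A : Omega1 → Set (Finset Pt)) :
    ∃ f : Omega1 → Level, ∀ δ, Correct (A δ) δ f (f δ) :=
  Omega1.exists_of_recursion (fun δ g v => Correct (A δ) δ g v)
    (fun _ _ _ _ h hv => hv.congr h)
    fun δ g hg => exists_correct (A δ) δ g fun β hβ => (hg β hβ).admissible

section Guess

variable {A : Omega1 → Set (Finset Pt)} {f : Omega1 → Level}

theorem pos_eq_iff (hf : ∀ δ, Admissible δ f (f δ)) {x y : Pt} :
    (f x.1).pos x.2 = (f y.1).pos y.2 ↔ x = y := by
  refine ⟨fun h => ?_, fun h => h ▸ rfl⟩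
  rcases lt_trichotomy x.1 y.1 with hlt | heq | hlt
  · exact ((hf y.1).pos_ne _ hlt _ _ h.symm).elim
  · rw [heq] at h
    exact Prod.ext heq ((hf y.1).pos_injective h)
  · exact ((hf x.1).pos_ne _ hlt _ _ h).elim

theorem exists_injective_cover (F : Finset Pt) (δ : Omega1) (hF : ∀ x ∈ F, δ ≤ x.1) :
    ∃ q : ℕ → Pt, Function.Injective q ∧ (∀ n, δ ≤ (q n).1) ∧ ∃ n, ∀ x ∈ F, ∃ j < n, q j = x := by
  let s : Set Pt := (F : Set Pt) ∪ range fun n : ℕ => (δ, n)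
  have hs : s.Countable := F.finite_toSet.countable.union (countable_range _)
  have hinf : s.Infinite :=
    (infinite_range_of_injective fun a b h => (Prod.ext_iff.1 h).2).mono subset_union_right
  have := hs.to_subtype
  have := hinf.to_subtype
  obtain ⟨e⟩ := nonempty_equiv_of_countable (α := ℕ) (β := s)
  refine ⟨fun n => e n, fun a b h => e.injective (Subtype.ext h), fun n => ?_, ?_⟩
  · rcases (e n).2 with h | ⟨m, h⟩
    · exact hF _ h
    · exact (congrArg Prod.fst h).le
  · obtain ⟨n, hn⟩ := (F.attach.image fun x : {x // x ∈ F} => e.symm ⟨x.1, Or.inl x.2⟩).bddAbove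
    refine ⟨n + 1, fun x hx => ⟨e.symm ⟨x, Or.inl hx⟩, Nat.lt_succ_of_le (hn ?_), by simp⟩⟩
    exact Finset.mem_coe.2 (Finset.mem_image.2 ⟨⟨x, hx⟩, Finset.mem_attach _ _, rfl⟩)

/-- If the guessed family is the trace of a family `B` that reflects to `δ`, and `B` has a member
above `δ`, then `δ` catches the guessed family. -/
theorem catches_of_reflects (hf : ∀ δ, Admissible δ f (f δ)) {δ : Omega1} {A B : Set (Finset Pt)}
    (hδ : ∃ b, b < δ) (hA : ∀ F, F ∈ A ↔ F ∈ B ∧ ∀ x ∈ F, x.1 < δ)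
    (hrefl : ∀ (G : Finset Pt) (l : ℕ) (P : Finset (Fin l → Bool)), (∀ p ∈ G, p.1 < δ) →
      (∃ F ∈ B, ∀ x ∈ F, (fun k : Fin l => (f x.1).pos x.2 k) ∈ P ∧ ∀ p ∈ G, Covers f p x.1) →
      ∃ F ∈ B, (∀ x ∈ F, x.1 < δ) ∧
        ∀ x ∈ F, (fun k : Fin l => (f x.1).pos x.2 k) ∈ P ∧ ∀ p ∈ G, Covers f p x.1)
    {K : Finset Pt} (hK : K ∈ B) (hKδ : ∀ x ∈ K, δ ≤ x.1) : Catches A δ f := by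
  classical
  obtain ⟨q, hq, hqδ, n, hn⟩ := exists_injective_cover K δ hKδ
  let T : Set Pt := {p | ∀ y ∈ K, Covers f p y.1}
  obtain ⟨b, hb⟩ := hδ
  obtain ⟨e, he⟩ := (Pt.countable_fst_lt δ).exists_eq_range ⟨(b, 0), hb⟩
  let G : ℕ → Finset Pt := fun i => ((Finset.range i).image e).filter (· ∈ T)
  have hS : ∀ i : ℕ, ∃ F ∈ B, (∀ x ∈ F, x.1 < δ) ∧
      ∀ x ∈ F, (fun k : Fin i => (f x.1).pos x.2 k) ∈
        K.image (fun y => fun k : Fin i => (f y.1).pos y.2 k) ∧ ∀ p ∈ G i, Covers f p x.1 := by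
    intro i
    refine hrefl (G i) i _ (fun p hp => ?_) ⟨K, hK, fun x hx => ⟨?_, fun p hp => ?_⟩⟩
    · obtain ⟨m, -, rfl⟩ := Finset.mem_image.1 (Finset.mem_filter.1 hp).1
      exact he.ge (mem_range_self m)
    · exact Finset.mem_image_of_mem _ hx
    · exact (Finset.mem_filter.1 hp).2 x hx
  choose S hSB hSδ hS using hS
  refine ⟨⟨T, fun j => (f (q j).1).pos (q j).2, S⟩, ⟨?_, ?_, ?_, hSδ, ⟨n, ?_⟩, ?_⟩,
    fun i => (hA _).2 ⟨hSB i, hSδ i⟩⟩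
  · exact fun a b hab => hq ((pos_eq_iff hf).1 hab)
  · intro β hβ i j h
    have : q j = (β, i) := (pos_eq_iff hf (x := q j) (y := (β, i))).1 h
    exact ((hqδ j).trans_eq (congrArg Prod.fst this)).not_gt hβ
  · intro β hβ H hH
    refine (frequently_covers (g := f) (β := β) (H ∪ K.image Prod.fst) (fun y _ => hf y)
      fun y hy => ?_).mono fun i hi p hp => ⟨fun y hy => ?_, fun y hy => ?_⟩
    · rcases Finset.mem_union.1 hy with hy | hy
      · exact (hH y hy).1
      · obtain ⟨x, hx, rfl⟩ := Finset.mem_image.1 hy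
        exact hβ.trans_le (hKδ x hx)
    · exact hi p hp _ (Finset.mem_union_right _ (Finset.mem_image_of_mem _ hy))
    · exact hi p hp y (Finset.mem_union_left _ hy)
  · intro i x hx
    obtain ⟨y, hy, hxy⟩ := Finset.mem_image.1 (hS i x hx).1
    obtain ⟨j, hj, rfl⟩ := hn y hy
    exact ⟨j, hj, fun k hk => (congrFun hxy ⟨k, hk⟩).symm⟩
  · intro p hp hpδ
    obtain ⟨m, rfl⟩ := he.le hpδ
    filter_upwards [eventually_gt_atTop m] with i hi x hx
    exact (hS i x hx).2 _ (Finset.mem_filter.2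
      ⟨Finset.mem_image_of_mem _ (Finset.mem_range.2 hi), hp⟩)

/-- A family of finite sets with members above every level has a countable subfamily that covers
every finite set of sufficiently high levels. -/
theorem exists_seq_covers
    (hA : ∀ (B : Set (Finset Pt)) (h : Omega1 → Omega1), ∃ δ, (∃ b, b < δ) ∧ (∀ β < δ, h β < δ) ∧
      ∀ F, F ∈ A δ ↔ F ∈ B ∧ ∀ x ∈ F, x.1 < δ)
    (hf : ∀ δ, Correct (A δ) δ f (f δ)) {B : Set (Finset Pt)}
    (hB : ∀ α : Omega1, ∃ F ∈ B, ∀ x ∈ F, α ≤ x.1) :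
    ∃ (δ : Omega1) (s : ℕ → Finset Pt), (∀ i, s i ∈ B) ∧
      ∀ H : Finset Omega1, (∀ y ∈ H, δ < y) → ∃ i, ∀ p ∈ s i, ∀ y ∈ H, Covers f p y := by
  classical
  let Φ : Finset Pt → (Σ l : ℕ, Finset (Fin l → Bool)) → Finset Pt → Prop := fun G c F =>
    ∀ x ∈ F, (fun k : Fin c.1 => (f x.1).pos x.2 k) ∈ c.2 ∧ ∀ p ∈ G, Covers f p x.1
  have hbound : ∀ F : Finset Pt, ∃ a : Omega1, ∀ x ∈ F, x.1 < a := fun F => by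
    obtain ⟨a, ha⟩ := Omega1.exists_gt_of_countable (F.finite_toSet.countable.image Prod.fst)
    exact ⟨a, fun x hx => ha _ ⟨x, hx, rfl⟩⟩
  have hw : ∀ G c, ∃ a : Omega1, (∃ F ∈ B, Φ G c F) → ∃ F ∈ B, (∀ x ∈ F, x.1 < a) ∧ Φ G c F := by
    intro G c
    by_cases h : ∃ F ∈ B, Φ G c F
    · obtain ⟨F, hF, hΦ⟩ := h
      obtain ⟨a, ha⟩ := hbound F
      exact ⟨a, fun _ => ⟨F, hF, ha, hΦ⟩⟩
    · exact ⟨Classical.arbitrary _, fun h' => (h h').elim⟩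
  choose w hw using hw
  have hk : ∀ β : Omega1, ∃ a : Omega1, ∀ (G : Finset Pt) c, (∀ p ∈ G, p.1 ≤ β) → w G c < a := by
    intro β
    obtain ⟨a, ha⟩ := Omega1.exists_gt_of_countable
      (((Pt.countable_finset_le β).prod countable_univ).image fun z => w z.1 z.2)
    exact ⟨a, fun G c hG => ha _ ⟨(G, c), mk_mem_prod hG (mem_univ _), rfl⟩⟩
  choose k hk using hk
  obtain ⟨δ, hδ, hkδ, hAδ⟩ := hA B k
  obtain ⟨K, hK, hKδ⟩ := hB δ
  have hc : Catches (A δ) δ f := by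
    refine catches_of_reflects (fun δ => (hf δ).admissible) hδ hAδ (fun G l c hG h => ?_) hK hKδ
    obtain ⟨F, hF, hFw, hΦ⟩ := hw G ⟨l, c⟩ h
    have hwδ : w G ⟨l, c⟩ < δ := by
      obtain ⟨b, hb⟩ := hδ
      rcases G.eq_empty_or_nonempty with rfl | hne
      · exact (hk b _ _ (by simp)).trans (hkδ b hb)
      · obtain ⟨x, hx, hmax⟩ := G.exists_max_image Prod.fst hne
        exact (hk x.1 G _ hmax).trans (hkδ _ (hG x hx))
    exact ⟨F, hF, fun x hx => (hFw x hx).trans hwδ, hΦ⟩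
  refine ⟨δ, (f δ).seq, fun i => ((hAδ _).1 ((hf δ).seq_mem hc i)).1, fun H hH => ?_⟩
  exact (frequently_covers H (fun y _ => (hf y).admissible) hH).exists

end Guess

end Level

/-- The set of points, with the topology determined by the chosen levels `f`. -/
def LevelSpace (_f : Omega1 → Level) : Type 1 := Pt

namespace LevelSpace

open Filter Topology Level

variable {f : Omega1 → Level}

/-- The subbasic open sets: the neighbourhoods attached to the points, and the cylinders given by
the positions in the Cantor set. -/
def subbasic (f : Omega1 → Level) : Pt ⊕ (ℕ × Bool) → Set (LevelSpace f)
  | .inl p => {x | Covers f p x.1}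
  | .inr c => {x | (f x.1).pos x.2 c.1 = c.2}

instance : TopologicalSpace (LevelSpace f) :=
  TopologicalSpace.generateFrom (range (subbasic f))

theorem isOpen_subbasic (a : Pt ⊕ (ℕ × Bool)) : IsOpen (subbasic f a) :=
  TopologicalSpace.isOpen_generateFrom_of_mem (mem_range_self a)

theorem t2Space (hf : ∀ δ, Admissible δ f (f δ)) : T2Space (LevelSpace f) := by
  refine ⟨fun x y hxy => ?_⟩
  have : (f x.1).pos x.2 ≠ (f y.1).pos y.2 := fun h => hxy ((pos_eq_iff hf).1 h)
  obtain ⟨k, hk⟩ := Function.ne_iff.1 this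
  refine ⟨_, _, isOpen_subbasic (.inr (k, (f x.1).pos x.2 k)),
    isOpen_subbasic (.inr (k, (f y.1).pos y.2 k)), rfl, rfl, ?_⟩
  rw [Set.disjoint_left]
  exact fun z hz hz' => hk (hz.symm.trans hz')

section Box

variable {ι : Type}

/-- The basic open boxes of the power of the space. -/
def box (f : Omega1 → Level) (G : Finset (ι × (Pt ⊕ (ℕ × Bool)))) : Set (ι → LevelSpace f) :=
  {x | ∀ a ∈ G, x a.1 ∈ subbasic f a.2}

theorem exists_box_of_isOpen {W : Set (ι → LevelSpace f)} (hW : IsOpen W) {x : ι → LevelSpace f}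
    (hx : x ∈ W) : ∃ G, x ∈ box f G ∧ box f G ⊆ W := by
  classical
  have hgen : (Pi.topologicalSpace : TopologicalSpace (ι → LevelSpace f)) = _ :=
    pi_generateFrom_eq
  rw [hgen] at hW
  induction hW with
  | basic U hU =>
    obtain ⟨s, I, hs, rfl⟩ := hU
    choose! a ha using hs
    refine ⟨I.image fun i => (i, a i), fun b hb => ?_, fun y hy i hi => ?_⟩
    · obtain ⟨i, hi, rfl⟩ := Finset.mem_image.1 hb
      simpa only [ha i hi] using hx i hi
    · rw [← ha i hi]
      exact hy (i, a i) (Finset.mem_image_of_mem _ hi)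
  | univ => exact ⟨∅, by simp [box], subset_univ _⟩
  | inter U V _ _ ihU ihV =>
    obtain ⟨G, hG, hGU⟩ := ihU hx.1
    obtain ⟨K, hK, hKV⟩ := ihV hx.2
    refine ⟨G ∪ K, fun a ha => ?_, fun y hy => ⟨hGU fun a ha => ?_, hKV fun a ha => ?_⟩⟩
    · exact (Finset.mem_union.1 ha).elim (hG a) (hK a)
    · exact hy a (Finset.mem_union_left _ ha)
    · exact hy a (Finset.mem_union_right _ ha)
  | sUnion S _ ih =>
    obtain ⟨U, hU, hxU⟩ := hx
    obtain ⟨G, hG, hGU⟩ := ih U hU hxU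
    exact ⟨G, hG, hGU.trans (subset_sUnion_of_mem hU)⟩

/-- Families of finite sets with members above every level have countable subfamilies covering all
finite sets of high levels. -/
def CoversFinite (f : Omega1 → Level) : Prop :=
  ∀ B : Set (Finset Pt), (∀ α : Omega1, ∃ F ∈ B, ∀ x ∈ F, α ≤ x.1) →
    ∃ (δ : Omega1) (s : ℕ → Finset Pt), (∀ i, s i ∈ B) ∧
      ∀ H : Finset Omega1, (∀ y ∈ H, δ < y) → ∃ i, ∀ p ∈ s i, ∀ y ∈ H, Covers f p y

theorem exists_countable_boxes_of_card [Fintype ι] (hf : CoversFinite f) (m : ℕ) :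
    ∀ 𝒢 : Set (Finset (ι × (Pt ⊕ (ℕ × Bool)))), (∀ G ∈ 𝒢, G.card = m) →
      ∃ 𝒢' ⊆ 𝒢, 𝒢'.Countable ∧ ∃ δ : Omega1, ∀ x : ι → LevelSpace f, (∀ i, δ < (x i).1) →
        ∀ G ∈ 𝒢, x ∈ box f G → ∃ G' ∈ 𝒢', x ∈ box f G' := by
  classical
  induction m with
  | zero =>
    intro 𝒢 h𝒢
    refine ⟨𝒢, Subset.rfl, (countable_singleton ∅).mono fun G hG => ?_,
      Classical.arbitrary _, fun x _ G hG hx => ⟨G, hG, hx⟩⟩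
    exact Finset.card_eq_zero.1 (h𝒢 G hG)
  | succ m ih =>
    intro 𝒢 h𝒢
    by_cases hcase : ∃ α : Omega1, ∀ G ∈ 𝒢, ∃ a ∈ G, ∀ p, a.2 = Sum.inl p → p.1 < α
    · obtain ⟨α, hα⟩ := hcase
      let K : Set (ι × (Pt ⊕ (ℕ × Bool))) := {a | ∀ p, a.2 = Sum.inl p → p.1 < α}
      have hK : K.Countable := by
        have h1 : (Sum.inl '' {p : Pt | p.1 < α} ∪ range Sum.inr :
            Set (Pt ⊕ (ℕ × Bool))).Countable :=
          ((Pt.countable_fst_lt α).image _).union (countable_range _)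
        refine (countable_univ.prod h1).mono fun a ha => mk_mem_prod (mem_univ _) ?_
        rcases h : a.2 with p | c
        · exact Or.inl ⟨p, ha p h, rfl⟩
        · exact Or.inr ⟨c, rfl⟩
      have hrec := fun a => ih {G | a ∉ G ∧ insert a G ∈ 𝒢} fun G hG => by
        have := h𝒢 _ hG.2
        rw [Finset.card_insert_of_notMem hG.1] at this
        omega
      choose 𝒮 h𝒮 h𝒮c ε hε using hrec
      obtain ⟨δ, hδ⟩ := Omega1.exists_gt_of_countable (hK.image ε)
      refine ⟨⋃ a ∈ K, insert a '' 𝒮 a, ?_, hK.biUnion fun a _ => (h𝒮c a).image _, δ, ?_⟩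
      · simp only [iUnion_subset_iff]
        rintro a - _ ⟨G, hG, rfl⟩
        exact (h𝒮 a hG).2
      · intro x hx G hG hxG
        obtain ⟨a, haG, ha⟩ := hα G hG
        obtain ⟨G', hG', hxG'⟩ := hε a x (fun i => (hδ _ ⟨a, ha, rfl⟩).trans (hx i)) (G.erase a)
          ⟨Finset.notMem_erase _ _, by rwa [Finset.insert_erase haG]⟩
          fun b hb => hxG b (Finset.mem_of_mem_erase hb)
        refine ⟨insert a G', mem_biUnion (x := a) ha ⟨G', hG', rfl⟩, fun b hb => ?_⟩
        rcases Finset.mem_insert.1 hb with rfl | hb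
        · exact hxG _ haG
        · exact hxG' b hb
    · push Not at hcase
      obtain ⟨δ, s, hs, hδ⟩ := hf {F | ∃ G ∈ 𝒢, ∀ a ∈ G, ∃ p ∈ F, a.2 = Sum.inl p} fun α => by
        obtain ⟨G, hG, hα⟩ := hcase α
        refine ⟨(G.image Prod.snd).toLeft, ⟨G, hG, fun a ha => ?_⟩, fun p hp => ?_⟩
        · obtain ⟨p, hp, -⟩ := hα a ha
          exact ⟨p, Finset.mem_toLeft.2 (hp ▸ Finset.mem_image_of_mem _ ha), hp⟩
        · obtain ⟨a, ha, hap⟩ := Finset.mem_image.1 (Finset.mem_toLeft.1 hp)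
          obtain ⟨q, hq, hαq⟩ := hα a ha
          rw [hap] at hq
          exact hαq.trans_eq (congrArg Prod.fst (Sum.inl.inj hq).symm)
      choose S hS𝒢 hS using hs
      refine ⟨range S, range_subset_iff.2 hS𝒢, countable_range S, δ, fun x hx _ _ _ => ?_⟩
      obtain ⟨i, hi⟩ := hδ (Finset.univ.image fun i => (x i).1) (by simpa using hx)
      refine ⟨S i, mem_range_self i, fun a ha => ?_⟩
      obtain ⟨p, hp, hap⟩ := hS i a ha
      rw [hap]
      exact hi p hp _ (Finset.mem_image_of_mem _ (Finset.mem_univ _))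

/-- Every open family in a finite power has a countable subfamily with the same union on the tuples
of high levels. -/
theorem exists_countable_subfamily [Fintype ι] (hf : CoversFinite f) {κ : Type*}
    (W : κ → Set (ι → LevelSpace f)) (hW : ∀ k, IsOpen (W k)) :
    ∃ t : Set κ, t.Countable ∧ ∃ δ : Omega1, ∀ x : ι → LevelSpace f, (∀ i, δ < (x i).1) →
      ∀ k, x ∈ W k → ∃ k ∈ t, x ∈ W k := by
  have hrec := fun m => exists_countable_boxes_of_card (ι := ι) hf m
    {G | G.card = m ∧ ∃ k, box f G ⊆ W k} fun G hG => hG.1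
  choose 𝒮 h𝒮 h𝒮c ε hε using hrec
  obtain ⟨δ, hδ⟩ := Omega1.exists_gt_range ε
  have hsub : ∀ G : ⋃ m, 𝒮 m, ∃ k, box f G.1 ⊆ W k := fun G => by
    obtain ⟨m, hm⟩ := mem_iUnion.1 G.2
    exact (h𝒮 m hm).2
  choose c hc using hsub
  have := (countable_iUnion h𝒮c).to_subtype
  refine ⟨range c, countable_range c, δ, fun x hx k hxk => ?_⟩
  obtain ⟨G, hxG, hGW⟩ := exists_box_of_isOpen (hW k) hxk
  obtain ⟨G', hG', hxG'⟩ := hε G.card x (fun i => (hδ _).trans (hx i)) G ⟨rfl, k, hGW⟩ hxG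
  exact ⟨_, mem_range_self ⟨G', mem_iUnion.2 ⟨_, hG'⟩⟩, hc _ hxG'⟩

end Box

theorem hereditarilyLindelofSpace (hf : CoversFinite f) :
    HereditarilyLindelofSpace (LevelSpace f) := by
  refine .of_forall_isOpen fun s _ => isLindelof_of_countable_subcover fun {κ} W hW hs => ?_
  obtain ⟨t, ht, δ, hδ⟩ := exists_countable_subfamily hf
    (fun k => (fun x : Unit → LevelSpace f => x ()) ⁻¹' W k)
    fun k => (hW k).preimage (continuous_apply ())
  have hc : {x : LevelSpace f | x.1 ≤ δ ∧ x ∈ s}.Countable :=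
    ((Omega1.countable_Iic δ).prod (countable_univ (α := ℕ))).mono
      fun x hx => mk_mem_prod hx.1 (mem_univ _)
  have hk : ∀ x : {x : LevelSpace f | x.1 ≤ δ ∧ x ∈ s}, ∃ k, x.1 ∈ W k :=
    fun x => mem_iUnion.1 (hs x.2.2)
  choose c hc' using hk
  have := hc.to_subtype
  refine ⟨t ∪ range c, ht.union (countable_range c), fun x hx => ?_⟩
  rcases le_or_gt x.1 δ with hxδ | hxδ
  · exact mem_biUnion (Or.inr (mem_range_self ⟨x, hxδ, hx⟩)) (hc' ⟨x, hxδ, hx⟩)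
  · obtain ⟨k, hk⟩ := mem_iUnion.1 (hs hx)
    obtain ⟨k', hk', hxk'⟩ := hδ (fun _ => x) (fun _ => hxδ) k hk
    exact mem_biUnion (Or.inl hk') hxk'

theorem lindelofSpace_pi (hf : CoversFinite f) (n : ℕ) : LindelofSpace (Fin n → LevelSpace f) := by
  induction n with
  | zero => infer_instance
  | succ n ih =>
    refine ⟨isLindelof_of_countable_subcover fun {κ} W hW hcov => ?_⟩
    obtain ⟨t, ht, δ, hδ⟩ := exists_countable_subfamily hf W hW
    have hc : {x : LevelSpace f | x.1 ≤ δ}.Countable :=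
      ((Omega1.countable_Iic δ).prod (countable_univ (α := ℕ))).mono
        fun x hx => mk_mem_prod hx (mem_univ _)
    have := hc.to_subtype
    have hL : IsLindelof (⋃ z : Fin (n + 1) × {x : LevelSpace f | x.1 ≤ δ},
        range fun y : Fin n → LevelSpace f =>
          (z.1.insertNth z.2.1 y : Fin (n + 1) → LevelSpace f)) :=
      isLindelof_iUnion fun z => isLindelof_range (continuous_const.finInsertNth z.1 continuous_id)
    obtain ⟨t', ht', hcov'⟩ := hL.elim_countable_subcover W hW ((subset_univ _).trans hcov)
    refine ⟨t ∪ t', ht.union ht', fun x _ => ?_⟩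
    by_cases hx : ∀ i, δ < (x i).1
    · obtain ⟨k, hk⟩ := mem_iUnion.1 (hcov (mem_univ x))
      obtain ⟨k', hk', hxk'⟩ := hδ x hx k hk
      exact mem_biUnion (Or.inl hk') hxk'
    · push Not at hx
      obtain ⟨i, hi⟩ := hx
      have hmem := hcov' (mem_iUnion.2 ⟨(i, ⟨x i, hi⟩), i.removeNth x, Fin.insertNth_self_removeNth i x⟩)
      obtain ⟨k, hk, hxk⟩ := mem_iUnion₂.1 hmem
      exact mem_biUnion (Or.inr hk) hxk

/-- A closed discrete set is met by the sequence of each level only finitely often. -/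
theorem eventually_seq_notMem {δ : Omega1} (hf : Admissible δ f (f δ)) {D : Set (LevelSpace f)}
    (hD : IsClosed D) (hd : DiscreteTopology D) :
    ∀ᶠ i in atTop, ∀ x ∈ (f δ).seq i, x ∉ D := by
  by_contra hfreq
  obtain ⟨n, hn⟩ := hf.seq_pos
  have hj : ∃ j < n, ∃ᶠ i in atTop, ∃ x ∈ (f δ).seq i, x ∈ D ∧
      ∀ k < i, (f x.1).pos x.2 k = (f δ).pos j k := by
    by_contra hcon
    apply hfreq
    have hall : ∀ᶠ i in atTop, ∀ j ∈ Finset.range n, ¬ ∃ x ∈ (f δ).seq i, x ∈ D ∧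
        ∀ k < i, (f x.1).pos x.2 k = (f δ).pos j k :=
      (eventually_all_finset _).2 fun j hj => not_frequently.1 fun h => hcon ⟨j, Finset.mem_range.1 hj, h⟩
    refine hall.mono fun i hi x hx hxD => ?_
    obtain ⟨j, hj, hxj⟩ := hn i x hx
    exact hi j (Finset.mem_range.2 hj) ⟨x, hx, hxD, hxj⟩
  obtain ⟨j, -, hj⟩ := hj
  obtain ⟨φ, hφ, hx⟩ := extraction_of_frequently_atTop hj
  choose x hxS hxD hxpos using hx
  let z : LevelSpace f := (δ, j)
  let u : ℕ → LevelSpace f := x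
  have hlim : Tendsto u atTop (𝓝 z) := by
    rw [TopologicalSpace.tendsto_nhds_generateFrom_iff]
    rintro _ ⟨p | ⟨k, b⟩, rfl⟩ hz
    · rcases lt_or_ge p.1 δ with hp | hp
      · have hp' : p ∈ (f δ).nbr := hz.resolve_left hp.not_ge
        exact (hφ.tendsto_atTop.eventually (hf.seq_nbr p hp' hp)).mono
          fun m hm => hm _ (hxS m)
      · exact Eventually.of_forall fun m => Or.inl ((hf.seq_lt _ _ (hxS m)).le.trans hp)
    · filter_upwards [hφ.tendsto_atTop.eventually_gt_atTop k] with m hm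
      exact (hxpos m k hm).trans hz
  have hzD : z ∈ D := hD.mem_of_tendsto hlim (Eventually.of_forall hxD)
  have hlimD : Tendsto (fun m => (⟨u m, hxD m⟩ : D)) atTop (𝓝 ⟨z, hzD⟩) :=
    tendsto_subtype_rng.2 hlim
  rw [nhds_discrete, tendsto_pure] at hlimD
  obtain ⟨m, hm⟩ := hlimD.exists
  have : (x m).1 = δ := congrArg (fun y : D => (y.1 : Pt).1) hm
  exact (hf.seq_lt _ _ (hxS m)).ne this

theorem not_isDSpace {A : Omega1 → Set (Finset Pt)}
    (hA : ∀ (B : Set (Finset Pt)) (h : Omega1 → Omega1), ∃ δ, (∃ b, b < δ) ∧ (∀ β < δ, h β < δ) ∧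
      ∀ F, F ∈ A δ ↔ F ∈ B ∧ ∀ x ∈ F, x.1 < δ)
    (hf : ∀ δ, Correct (A δ) δ f (f δ)) (hL : HereditarilyLindelofSpace (LevelSpace f)) :
    ¬ IsDSpace (LevelSpace f) := by
  intro hDS
  obtain ⟨D, hD, hd, hcov⟩ := hDS (fun x => subbasic f (.inl x))
    fun x => ⟨isOpen_subbasic _, Or.inl le_rfl⟩
  have hDc : D.Countable := (HereditarilyLindelofSpace.isLindelof D).countable hd
  obtain ⟨α, hα⟩ := Omega1.exists_gt_of_countable (hDc.image fun x => x.1)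
  obtain ⟨δ, ⟨b, hb⟩, hδ, hAδ⟩ := hA {F | ∃ x ∈ D, F = {x}} fun _ => α
  have hDδ : ∀ x ∈ D, x.1 < δ := fun x hx => (hα _ ⟨x, hx, rfl⟩).trans (hδ b hb)
  have hAD : ∀ p : Pt, (∀ F ∈ A δ, p ∉ F) ↔ p ∉ D := by
    intro p
    refine ⟨fun h hp => h {p} ((hAδ _).2 ⟨⟨p, hp, rfl⟩, ?_⟩) (by simp), fun h F hF hpF => ?_⟩
    · simpa using hDδ p hp
    · obtain ⟨x, hx, rfl⟩ := ((hAδ F).1 hF).1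
      exact h ((Finset.mem_singleton.1 hpF : p = x) ▸ hx)
  have hmiss := fun β => eventually_seq_notMem (hf β).admissible hD hd
  have hc : ¬ Catches (A δ) δ f := fun hc => by
    obtain ⟨i, hi⟩ := (hmiss δ).exists
    obtain ⟨x, hx, hxi⟩ := ((hAδ _).1 ((hf δ).seq_mem hc i)).1
    exact hi x (by rw [hxi]; exact Finset.mem_singleton_self x) hx
  have ha : Avoids (A δ) δ f := fun β _ H hH =>
    ((frequently_covers H (fun y _ => (hf y).admissible) fun y hy => (hH y hy).1).and_eventually
      (hmiss β)).mono fun i hi p hp => ⟨(hAD p).2 (hi.2 p hp), hi.1 p hp⟩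
  have hz : ((δ, 0) : Pt) ∈ ⋃ x ∈ D, subbasic f (.inl x) := hcov ▸ mem_univ _
  obtain ⟨x, hx, hzx⟩ := mem_iUnion₂.1 hz
  rcases hzx with h | h
  · exact (hDδ x hx).not_ge h
  · exact (hAD x).1 ((hf δ).nbr_disjoint hc ha x h) hx

end LevelSpace

/-- Assuming `◊`, there is a Hausdorff hereditarily Lindelöf space of size `ω₁`
that is not a `D`-space and all of whose finite powers are Lindelöf. -/
theorem statement6 (hd : DiamondPrinciple) :
    ∃ (X : Type 1) (τ : TopologicalSpace X),
      Cardinal.mk X = Cardinal.aleph 1 ∧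
      @T2Space X τ ∧ @HereditarilyLindelofSpace X τ ∧ ¬ @IsDSpace X τ ∧
      ∀ n : ℕ, 1 ≤ n →
        @LindelofSpace (Fin n → X) (@Pi.topologicalSpace (Fin n) (fun _ => X) (fun _ => τ)) := by
  obtain ⟨A, hA⟩ := hd.exists_finset_guess
  obtain ⟨f, hf⟩ := Level.exists_correct_levels A
  have hcov : LevelSpace.CoversFinite f := fun B hB => Level.exists_seq_covers hA hf hB
  have hL := LevelSpace.hereditarilyLindelofSpace hcov
  exact ⟨LevelSpace f, inferInstance, Pt.mk_eq, LevelSpace.t2Space fun δ => (hf δ).admissible, hL,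
    LevelSpace.not_isDSpace hA hf hL, fun n _ => LevelSpace.lindelofSpace_pi hcov n⟩
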